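/- Let x be a complex number and α, β complex numbers such that none of 2α, 2β, α+1/2, β+1/2, and α+β is a nonpositive integer. Then ₁F₁(α; 2α; x) · ₁F₁(β; 2β; x) = e^x · ₂F₃((α+β)/2, (α+β+1)/2; α+1/2, β+1/2, α+β; x²/4). -/

import Mathlib

/-- Pochhammer symbol (rising factorial) `(c)_k = c (c+1) ⋯ (c+k-1)` for complex `c`. -/
noncomputable def poch (c : ℂ) (k : ℕ) : ℂ := ∏ l ∈ Finset.range k, (c + l)

/-- Generalized hypergeometric series `ₚF_q(a; b; x) = Σ_k (a₁)_k⋯(a_p)_k / ((b₁)_k⋯(b_q)_k) · x^k/k!`. -/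
noncomputable def pFq (a b : List ℂ) (x : ℂ) : ℂ :=
  ∑' k : ℕ, ((a.map (fun c => poch c k)).prod / (b.map (fun c => poch c k)).prod)
    * x ^ k / (Nat.factorial k)

/-- `c` is not a nonpositive integer, i.e. `c ≠ 0, -1, -2, …`. -/
def NotNonposInt (c : ℂ) : Prop := ∀ n : ℕ, c ≠ -(n : ℂ)

open Finset PowerSeries

lemma poch_succ (c : ℂ) (k : ℕ) : poch c (k + 1) = poch c k * (c + k) :=
  prod_range_succ _ _

lemma poch_add (c : ℂ) (m n : ℕ) : poch c (m + n) = poch c m * poch (c + m) n := by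
  simp [poch, prod_range_add, add_assoc]

lemma NotNonposInt.add_natCast_ne_zero {c : ℂ} (h : NotNonposInt c) (n : ℕ) : c + n ≠ 0 :=
  fun h0 => h n (eq_neg_of_add_eq_zero_left h0)

lemma NotNonposInt.poch_ne_zero {c : ℂ} (h : NotNonposInt c) (k : ℕ) : poch c k ≠ 0 :=
  prod_ne_zero_iff.mpr fun l _ => h.add_natCast_ne_zero l

lemma ascPochhammer_eval_eq_poch (c : ℂ) (k : ℕ) : (ascPochhammer ℂ k).eval c = poch c k := by
  induction k with
  | zero => simp [poch]
  | succ k ih => rw [ascPochhammer_succ_eval, ih, poch_succ]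

lemma descPochhammer_smeval_eq_poch (c : ℂ) (k : ℕ) :
    (descPochhammer ℤ k).smeval c = poch (c - k + 1) k := by
  rw [Polynomial.descPochhammer_smeval_eq_ascPochhammer, Polynomial.ascPochhammer_smeval_eq_eval,
    ascPochhammer_eval_eq_poch]

/-- The duplication formula for the Pochhammer symbol. -/
lemma poch_two_mul (c : ℂ) (n : ℕ) :
    poch c (2 * n) = poch (c / 2) n * poch ((c + 1) / 2) n * 4 ^ n := by
  induction n with
  | zero => simp [poch]
  | succ n ih =>
    rw [mul_add_one, poch_succ _ (2 * n + 1), poch_succ _ (2 * n), ih, poch_succ, poch_succ]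
    push_cast
    ring

/-- A form of the Chu-Vandermonde identity. -/
lemma poch_chu_vandermonde (a b : ℂ) (n : ℕ) :
    poch (a + b - 1 + n) n =
      ∑ ij ∈ antidiagonal n, n.choose ij.1 * (poch (b + ij.2) ij.1 * poch (a + ij.1) ij.2) := by
  have h := Ring.descPochhammer_smeval_add n (Commute.all (b + n - 1) (a + n - 1))
  simp only [descPochhammer_smeval_eq_poch] at h
  convert h using 1
  · congr 1; ring
  · refine sum_congr rfl fun ij hij => ?_
    have hn : (n : ℂ) = ij.1 + ij.2 := by exact_mod_cast (mem_antidiagonal.mp hij).symm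
    rw [hn]
    congr 3 <;> ring

lemma pFq_zero_one (a z : ℂ) :
    pFq [] [a] z = ∑' k : ℕ, (poch a k)⁻¹ * z ^ k / k.factorial := by
  simp [pFq]

lemma summable_norm_zero_one (a z : ℂ) :
    Summable fun k : ℕ => ‖(poch a k)⁻¹ * z ^ k / k.factorial‖ := by
  refine summable_of_ratio_norm_eventually_le (r := 1 / 2) (by norm_num) ?_
  filter_upwards [Filter.eventually_ge_atTop ⌈‖a‖ + 1 + 2 * ‖z‖⌉₊] with k hk
  have hk' : ‖a‖ + 1 + 2 * ‖z‖ ≤ k := Nat.ceil_le.mp hk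
  have hak : 1 + 2 * ‖z‖ ≤ ‖a + k‖ := by
    have := norm_sub_le (a + k) a
    rw [add_sub_cancel_left, Complex.norm_natCast] at this
    linarith
  have hterm : (poch a (k + 1))⁻¹ * z ^ (k + 1) / (k + 1).factorial =
      z / ((a + k) * (k + 1 : ℕ)) * ((poch a k)⁻¹ * z ^ k / k.factorial) := by
    rw [poch_succ, Nat.factorial_succ, pow_succ, Nat.cast_mul]
    simp only [div_eq_mul_inv, mul_inv]
    ring
  rw [norm_norm, norm_norm, hterm, norm_mul]
  refine mul_le_mul_of_nonneg_right ?_ (norm_nonneg _)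
  rw [norm_div, norm_mul, Complex.norm_natCast]
  have hk1 : (1 : ℝ) ≤ (k + 1 : ℕ) := by exact_mod_cast Nat.le_add_left 1 k
  have hz := norm_nonneg z
  have hak0 : 0 < ‖a + k‖ := by linarith
  rw [div_le_iff₀ (by positivity)]
  nlinarith [mul_le_mul hak hk1 zero_le_one (by positivity)]

/-- The product of two `₀F₁` series with the same argument is a `₂F₃` series. -/
lemma pFq_zero_one_mul {a b : ℂ} (ha : NotNonposInt a) (hb : NotNonposInt b)
    (hab : NotNonposInt (a + b - 1)) (z : ℂ) :
    pFq [] [a] z * pFq [] [b] z =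
      pFq [(a + b - 1) / 2, (a + b - 1 + 1) / 2] [a, b, a + b - 1] (4 * z) := by
  rw [pFq_zero_one, pFq_zero_one, tsum_mul_tsum_eq_tsum_sum_antidiagonal_of_summable_norm
    (summable_norm_zero_one a z) (summable_norm_zero_one b z), pFq]
  refine tsum_congr fun n => ?_
  have hn : (n.factorial : ℂ) ≠ 0 := by exact_mod_cast n.factorial_ne_zero
  have hpa := ha.poch_ne_zero n
  have hpb := hb.poch_ne_zero n
  have hpc := hab.poch_ne_zero n
  trans poch (a + b - 1 + n) n * ((poch a n)⁻¹ * (poch b n)⁻¹ * z ^ n / n.factorial)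
  · rw [poch_chu_vandermonde, sum_mul]
    refine sum_congr rfl fun ⟨i, j⟩ hij => ?_
    obtain rfl : i + j = n := mem_antidiagonal.mp hij
    have hfi : (i.factorial : ℂ) ≠ 0 := by exact_mod_cast i.factorial_ne_zero
    have hfj : (j.factorial : ℂ) ≠ 0 := by exact_mod_cast j.factorial_ne_zero
    have hpb' : poch b (i + j) = poch b j * poch (b + j) i := by rw [add_comm, poch_add]
    rw [hpb'] at hpb
    rw [poch_add] at hpa
    rw [Nat.cast_add_choose, hpb', poch_add, pow_add]
    have h1 := right_ne_zero_of_mul hpa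
    have h2 := right_ne_zero_of_mul hpb
    field_simp
  · have h := poch_two_mul (a + b - 1) n
    rw [two_mul, poch_add] at h
    simp only [List.map_cons, List.map_nil, List.prod_cons, List.prod_nil, mul_one]
    rw [mul_pow]
    field_simp
    linear_combination z ^ n * h

lemma tsum_coeff_mul_mul_pow {P Q : PowerSeries ℂ} {x : ℂ}
    (hP : Summable fun n : ℕ => ‖coeff n P * x ^ n‖)
    (hQ : Summable fun n : ℕ => ‖coeff n Q * x ^ n‖) :
    ∑' n : ℕ, coeff n (P * Q) * x ^ n =
      (∑' n : ℕ, coeff n P * x ^ n) * ∑' n : ℕ, coeff n Q * x ^ n := by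
  rw [tsum_mul_tsum_eq_tsum_sum_antidiagonal_of_summable_norm hP hQ]
  refine tsum_congr fun n => ?_
  rw [coeff_mul, sum_mul]
  refine sum_congr rfl fun ij hij => ?_
  rw [← mem_antidiagonal.mp hij, pow_add]
  ring

/-- The power series in `x` of `₀F₁(a; x²/16)`. -/
noncomputable def zeroOneSeries (a : ℂ) : PowerSeries ℂ :=
  mk fun n => if Even n then (poch a (n / 2))⁻¹ * (1 / 16) ^ (n / 2) / (n / 2).factorial else 0

lemma coeff_zeroOneSeries_two_mul (a : ℂ) (k : ℕ) :
    coeff (2 * k) (zeroOneSeries a) = (poch a k)⁻¹ * (1 / 16) ^ k / k.factorial := by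
  simp [zeroOneSeries]

lemma coeff_zeroOneSeries_of_not_even (a : ℂ) {n : ℕ} (hn : ¬Even n) :
    coeff n (zeroOneSeries a) = 0 := by
  simp [zeroOneSeries, hn]

lemma coeff_zeroOneSeries_two_mul_mul_pow (a x : ℂ) (k : ℕ) :
    coeff (2 * k) (zeroOneSeries a) * x ^ (2 * k) =
      (poch a k)⁻¹ * (x ^ 2 / 16) ^ k / k.factorial := by
  rw [coeff_zeroOneSeries_two_mul, pow_mul, div_eq_mul_one_div (x ^ 2), mul_pow]
  ring

lemma coeff_zeroOneSeries_mul_pow_eq_zero (a x : ℂ) {n : ℕ}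
    (hn : n ∉ Set.range fun k : ℕ => 2 * k) : coeff n (zeroOneSeries a) * x ^ n = 0 := by
  rw [coeff_zeroOneSeries_of_not_even, zero_mul]
  rintro ⟨k, rfl⟩
  exact hn ⟨k, two_mul k⟩

lemma summable_norm_zeroOneSeries (a x : ℂ) :
    Summable fun n : ℕ => ‖coeff n (zeroOneSeries a) * x ^ n‖ := by
  have hinj : Function.Injective fun k : ℕ => 2 * k := mul_right_injective₀ two_ne_zero
  rw [← hinj.summable_iff fun n hn => by
    rw [coeff_zeroOneSeries_mul_pow_eq_zero a x hn, norm_zero]]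
  simpa only [Function.comp_def, coeff_zeroOneSeries_two_mul_mul_pow] using
    summable_norm_zero_one a (x ^ 2 / 16)

lemma tsum_zeroOneSeries (a x : ℂ) :
    ∑' n : ℕ, coeff n (zeroOneSeries a) * x ^ n = pFq [] [a] (x ^ 2 / 16) := by
  have hinj : Function.Injective fun k : ℕ => 2 * k := mul_right_injective₀ two_ne_zero
  rw [← hinj.tsum_eq (Function.support_subset_iff'.mpr fun n hn =>
    coeff_zeroOneSeries_mul_pow_eq_zero a x hn), pFq_zero_one]
  exact tsum_congr fun k => coeff_zeroOneSeries_two_mul_mul_pow a x k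

/-- The power series in `x` of `exp (x/2)`. -/
noncomputable def expHalfSeries : PowerSeries ℂ :=
  mk fun n => (1 / 2) ^ n / n.factorial

lemma coeff_expHalfSeries_mul_pow (x : ℂ) (n : ℕ) :
    coeff n expHalfSeries * x ^ n = (x / 2) ^ n / n.factorial := by
  rw [expHalfSeries, coeff_mk, div_eq_mul_one_div x, mul_pow]
  ring

lemma derivative_expHalfSeries : d⁄dX ℂ expHalfSeries = C (1 / 2) * expHalfSeries := by
  ext n
  have h : ((n : ℂ) + 1) ≠ 0 := by exact_mod_cast n.succ_ne_zero
  have hn : (n.factorial : ℂ) ≠ 0 := by exact_mod_cast n.factorial_ne_zero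
  rw [coeff_derivative, coeff_C_mul, expHalfSeries, coeff_mk, coeff_mk, Nat.factorial_succ, pow_succ]
  push_cast
  field_simp

lemma zeroOneSeries_ode {α : ℂ} (h : NotNonposInt (α + 1 / 2)) :
    X * d⁄dX ℂ (d⁄dX ℂ (zeroOneSeries (α + 1 / 2)))
      + C (2 * α) * d⁄dX ℂ (zeroOneSeries (α + 1 / 2))
      - C (1 / 4) * (X * zeroOneSeries (α + 1 / 2)) = 0 := by
  ext n
  rcases n with _ | n
  · simp only [map_add, map_sub, map_zero, coeff_C_mul, coeff_zero_X_mul, coeff_derivative]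
    rw [coeff_zeroOneSeries_of_not_even (n := 0 + 1) _ (by simp)]
    simp
  · simp only [map_add, map_sub, map_zero, coeff_C_mul, coeff_succ_X_mul, coeff_derivative]
    by_cases hn : Even n
    · obtain ⟨k, rfl⟩ := even_iff_two_dvd.mp hn
      have h1 : ((k : ℂ) + 1) ≠ 0 := by exact_mod_cast k.succ_ne_zero
      have h2 : (k.factorial : ℂ) ≠ 0 := by exact_mod_cast k.factorial_ne_zero
      have h3 := h.poch_ne_zero k
      have h4 := h.add_natCast_ne_zero k
      rw [show 2 * k + 1 + 1 = 2 * (k + 1) by ring, coeff_zeroOneSeries_two_mul,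
        coeff_zeroOneSeries_two_mul, poch_succ, Nat.factorial_succ, pow_succ, mul_inv]
      generalize hu : (poch (α + 1 / 2) k)⁻¹ = u
      have h5 : (α + 1 / 2 + k) * (α + 1 / 2 + k)⁻¹ = 1 := mul_inv_cancel₀ h4
      generalize (α + 1 / 2 + k)⁻¹ = v at h5
      push_cast
      field_simp
      linear_combination (16 * (k + 1) * u * (1 / 16) ^ k) * h5
    · rw [coeff_zeroOneSeries_of_not_even _ hn,
        coeff_zeroOneSeries_of_not_even (n := n + 1 + 1) _ (by simpa [Nat.even_add_one] using hn)]
      simp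

/-- The Kummer equation satisfied by `exp (x/2) ₀F₁(α + 1/2; x²/16)`. -/
lemma expHalfSeries_mul_zeroOneSeries_ode {α : ℂ} (h : NotNonposInt (α + 1 / 2)) :
    X * d⁄dX ℂ (d⁄dX ℂ (expHalfSeries * zeroOneSeries (α + 1 / 2)))
      + C (2 * α) * d⁄dX ℂ (expHalfSeries * zeroOneSeries (α + 1 / 2))
      - X * d⁄dX ℂ (expHalfSeries * zeroOneSeries (α + 1 / 2))
      - C α * (expHalfSeries * zeroOneSeries (α + 1 / 2)) = 0 := by
  have hode := zeroOneSeries_ode h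
  generalize zeroOneSeries (α + 1 / 2) = G at hode ⊢
  have hhalf : (C (1 / 2) : PowerSeries ℂ) * 2 = 1 := by
    rw [← map_ofNat C 2, ← map_mul]; simp
  have hquarter : (C (1 / 4) : PowerSeries ℂ) = C (1 / 2) * C (1 / 2) := by
    rw [← map_mul]; norm_num
  have htwo : (C (2 * α) : PowerSeries ℂ) = 2 * C α := by
    rw [map_mul, map_ofNat]
  have hC : d⁄dX ℂ (C (1 / 2) : PowerSeries ℂ) = 0 := derivative_C
  rw [hquarter, htwo] at hode
  rw [htwo]
  simp only [Derivation.leibniz, map_add, smul_eq_mul, derivative_expHalfSeries, hC]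
  generalize (C (1 / 2) : PowerSeries ℂ) = c at *
  linear_combination expHalfSeries * hode +
    (X * expHalfSeries * d⁄dX ℂ G + C α * expHalfSeries * G + X * expHalfSeries * G * c) * hhalf

lemma coeff_expHalfSeries_mul_zeroOneSeries {α : ℂ} (h1 : NotNonposInt (2 * α))
    (h : NotNonposInt (α + 1 / 2)) (n : ℕ) :
    coeff n (expHalfSeries * zeroOneSeries (α + 1 / 2)) =
      poch α n / poch (2 * α) n / n.factorial := by
  have hode := expHalfSeries_mul_zeroOneSeries_ode h
  have h0 : coeff 0 (expHalfSeries * zeroOneSeries (α + 1 / 2)) = 1 := by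
    simp [expHalfSeries, zeroOneSeries, poch]
  generalize expHalfSeries * zeroOneSeries (α + 1 / 2) = H at *
  have hrec (n : ℕ) : (2 * α + n) * (n + 1) * coeff (n + 1) H = (α + n) * coeff n H := by
    have hc := congrArg (coeff n) hode
    rcases n with _ | n
    · simp only [map_add, map_sub, map_zero, coeff_C_mul, coeff_zero_X_mul, coeff_derivative] at hc
      push_cast at hc ⊢
      linear_combination hc
    · simp only [map_add, map_sub, map_zero, coeff_C_mul, coeff_succ_X_mul, coeff_derivative] at hc
      push_cast at hc ⊢
      linear_combination hc
  induction n with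
  | zero => simp [h0, poch]
  | succ n ih =>
    have h2 := h1.add_natCast_ne_zero n
    have h3 : ((n : ℂ) + 1) ≠ 0 := by exact_mod_cast n.succ_ne_zero
    have h4 := h1.poch_ne_zero n
    have h5 : (n.factorial : ℂ) ≠ 0 := by exact_mod_cast n.factorial_ne_zero
    apply mul_left_cancel₀ (mul_ne_zero h2 h3)
    rw [hrec, ih, poch_succ, poch_succ, Nat.factorial_succ]
    push_cast
    generalize 2 * α = c at h2 h4 ⊢
    field_simp

/-- Kummer's second theorem. -/
lemma pFq_one_one_two_mul {α : ℂ} (h1 : NotNonposInt (2 * α)) (h : NotNonposInt (α + 1 / 2))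
    (x : ℂ) : pFq [α] [2 * α] x = Complex.exp (x / 2) * pFq [] [α + 1 / 2] (x ^ 2 / 16) := by
  have hexp : Summable fun n : ℕ => ‖coeff n expHalfSeries * x ^ n‖ := by
    simpa only [coeff_expHalfSeries_mul_pow] using
      NormedSpace.norm_expSeries_div_summable (x / 2)
  rw [← tsum_zeroOneSeries, Complex.exp_eq_exp_ℂ, NormedSpace.exp_eq_tsum_div]
  simp only [← coeff_expHalfSeries_mul_pow]
  rw [← tsum_coeff_mul_mul_pow hexp (summable_norm_zeroOneSeries _ x), pFq]
  refine tsum_congr fun n => ?_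
  rw [coeff_expHalfSeries_mul_zeroOneSeries h1 h]
  simp only [List.map_cons, List.map_nil, List.prod_cons, List.prod_nil, mul_one]
  ring

theorem bailey_identity_exp_form (x α β : ℂ)
    (h1 : NotNonposInt (2*α)) (h2 : NotNonposInt (2*β))
    (h3 : NotNonposInt (α + 1/2)) (h4 : NotNonposInt (β + 1/2))
    (h5 : NotNonposInt (α + β)) :
    pFq [α] [2*α] x * pFq [β] [2*β] x =
      Complex.exp x * pFq [(α+β)/2, (α+β+1)/2] [α+1/2, β+1/2, α+β] (x^2/4) := by
  have hab : α + 1 / 2 + (β + 1 / 2) - 1 = α + β := by ring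
  have hmul := pFq_zero_one_mul h3 h4 (by rwa [hab]) (x ^ 2 / 16)
  rw [hab, show 4 * (x ^ 2 / 16) = x ^ 2 / 4 by ring] at hmul
  rw [pFq_one_one_two_mul h1 h3, pFq_one_one_two_mul h2 h4, ← hmul, ← add_halves x,
    Complex.exp_add, add_halves]
  ring
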